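/- Let λ > 0 and let a : ℝ → ℝ be continuous with 0 ≤ a(s) ≤ λ for all s. Define F(u) = ∫₀ᵘ (2λ - a(s)) ds and K(t,u) = F⁻¹(t + F(u)). Then for all t, u ∈ ℝ one has |K(t,u)| ≤ (1/λ)|t + F(u)|, and whenever t + F(u) ≥ 0 one has (1/(2λ))(t + F(u)) ≤ K(t,u) ≤ (1/λ)(t + F(u)). -/

import Mathlib

theorem mul_sub_le_intervalIntegral {f : ℝ → ℝ} (hf : Continuous f) {c : ℝ}
    (hc : ∀ s, c ≤ f s) {x y : ℝ} (hxy : x ≤ y) : c * (y - x) ≤ ∫ s in x..y, f s := by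
  have h := intervalIntegral.integral_mono_on (μ := MeasureTheory.volume) hxy
    (continuous_const.intervalIntegrable x y) (hf.intervalIntegrable x y) (fun s _ => hc s)
  rw [intervalIntegral.integral_const, smul_eq_mul] at h
  linarith

theorem intervalIntegral_le_mul_sub {f : ℝ → ℝ} (hf : Continuous f) {C : ℝ}
    (hC : ∀ s, f s ≤ C) {x y : ℝ} (hxy : x ≤ y) : (∫ s in x..y, f s) ≤ C * (y - x) := by
  have h := intervalIntegral.integral_mono_on (μ := MeasureTheory.volume) hxy
    (hf.intervalIntegrable x y) (continuous_const.intervalIntegrable x y) (fun s _ => hC s)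
  rw [intervalIntegral.integral_const, smul_eq_mul] at h
  linarith

theorem surjective_primitive_of_pos_le {f : ℝ → ℝ} (hf : Continuous f) {c : ℝ} (hc0 : 0 < c)
    (hc : ∀ s, c ≤ f s) : Function.Surjective fun u => ∫ s in (0 : ℝ)..u, f s := by
  refine (intervalIntegral.continuous_primitive
    (fun x y => hf.intervalIntegrable x y) 0).surjective ?_ ?_
  · refine Filter.tendsto_atTop_mono' _ ?_ (Filter.tendsto_id.const_mul_atTop hc0)
    filter_upwards [Filter.eventually_ge_atTop (0 : ℝ)] with u hu
    simpa using mul_sub_le_intervalIntegral hf hc hu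
  · refine Filter.tendsto_atBot_mono' _ ?_ (Filter.tendsto_id.const_mul_atBot hc0)
    filter_upwards [Filter.eventually_le_atBot (0 : ℝ)] with u hu
    have h := mul_sub_le_intervalIntegral hf hc hu
    rw [intervalIntegral.integral_symm] at h
    simp only [id]
    linarith

/-- c-boundedness estimates for the flow map: with `F(u) = ∫₀ᵘ (2λ - a(s)) ds` and
`K(t,u) = F⁻¹(t + F(u))`, one has `|K(t,u)| ≤ (1/λ)|t + F(u)|`, and whenever
`t + F(u) ≥ 0`, `(1/(2λ))(t + F(u)) ≤ K(t,u) ≤ (1/λ)(t + F(u))`. -/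
theorem stmt8 (lam : ℝ) (hlam : 0 < lam) (a : ℝ → ℝ) (ha : Continuous a)
    (ha0 : ∀ s, 0 ≤ a s) (ha1 : ∀ s, a s ≤ lam)
    (F : ℝ → ℝ) (hF : ∀ u, F u = ∫ s in (0 : ℝ)..u, (2 * lam - a s))
    (K : ℝ → ℝ → ℝ) (hK : ∀ t u, K t u = Function.invFun F (t + F u)) :
    ∀ t u : ℝ, |K t u| ≤ (1 / lam) * |t + F u| ∧
      (0 ≤ t + F u →
        (1 / (2 * lam)) * (t + F u) ≤ K t u ∧ K t u ≤ (1 / lam) * (t + F u)) := by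
  intro t u
  have hf : Continuous fun s => 2 * lam - a s := continuous_const.sub ha
  have hl : ∀ s, lam ≤ 2 * lam - a s := fun s => by linarith [ha1 s]
  have hu : ∀ s, 2 * lam - a s ≤ 2 * lam := fun s => by linarith [ha0 s]
  have hsurj : Function.Surjective F := by
    rw [funext hF]
    exact surjective_primitive_of_pos_le hf hlam hl
  have hFK : F (K t u) = t + F u := by
    rw [hK]
    exact Function.invFun_eq (hsurj _)
  rw [← hFK]
  generalize K t u = k
  rw [one_div_mul_eq_div, one_div_mul_eq_div, one_div_mul_eq_div, le_div_iff₀ hlam,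
    le_div_iff₀ hlam, div_le_iff₀ (by positivity)]
  rcases le_total 0 k with hk | hk
  · have h1 := mul_sub_le_intervalIntegral hf hl hk
    have h2 := intervalIntegral_le_mul_sub hf hu hk
    rw [← hF] at h1 h2
    have hFk : 0 ≤ F k := by nlinarith
    rw [abs_of_nonneg hk, abs_of_nonneg hFk]
    exact ⟨by linarith, fun _ => ⟨by linarith, by linarith⟩⟩
  · have h1 := mul_sub_le_intervalIntegral hf hl hk
    rw [intervalIntegral.integral_symm, ← hF] at h1
    have hFk : F k ≤ 0 := by nlinarith
    rw [abs_of_nonpos hk, abs_of_nonpos hFk]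
    refine ⟨by linarith, fun h => ?_⟩
    have hk0 : k = 0 := by nlinarith
    subst hk0
    constructor <;> linarith
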